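/- arXiv:1503.07245 — 2 statements merged into one kernel-verified Lean document; each statement's English description precedes it below -/
import Mathlib

section
/- In the discrete setup, let λ : ℝ^k → ℝ be a function such that λ(α) is an eigenvalue of H^α for every α ∈ ℝ^k, let α* ∈ ℝ^k be a critical point of λ (λ is differentiable at α* and its total derivative there is zero), suppose the eigenvalue λ(α*) of H^{α*} is simple (its eigenspace over ℂ is one-dimensional), suppose there exists j with sin(α*_j) ≠ 0 (i.e., α* is not at a symmetry point of the Brillouin zone), and let f : V → ℂ be an eigenvector of H^{α*} for λ(α*) with f(v_j) ≠ 0 and f(u_j) ≠ 0 for all j = 1,…,k. Then: (1) γ*_j := e^{iα*_j}·f(u_j)/f(v_j) is a nonzero real number for every j; and (2) λ(α*) is a degenerate eigenvalue of the (real symmetric) matrix H^{γ*}: its eigenspace over ℂ has dimension at least 2. -/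
open Matrix Complex BigOperators

/-- The magnetic hopping matrix `M^α`: its only nonzero entries are
`M^α_{v_j, u_j} = e^{i α_j}` and `M^α_{u_j, v_j} = e^{-i α_j}`. -/
noncomputable def magM {V : Type*} [Fintype V] [DecidableEq V] {k : ℕ}
    (v u : Fin k → V) (α : Fin k → ℝ) : Matrix V V ℂ := fun x y =>
  (∑ j, if x = v j ∧ y = u j then Complex.exp (Complex.I * α j) else 0) +
  (∑ j, if x = u j ∧ y = v j then Complex.exp (-(Complex.I * α j)) else 0)

/-- The magnetic discrete Schrödinger operator `H^α = Q - C - M^α` on the fundamental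
domain: `Q` is the diagonal potential, `C` the adjacency matrix of `G`. -/
noncomputable def magH {V : Type*} [Fintype V] [DecidableEq V]
    (G : SimpleGraph V) [DecidableRel G.Adj] (q : V → ℝ) {k : ℕ}
    (v u : Fin k → V) (α : Fin k → ℝ) : Matrix V V ℂ :=
  Matrix.diagonal (fun x => (q x : ℂ)) - G.adjMatrix ℂ - magM v u α

/-- The diagonal matrix `M^γ`: its only nonzero entries are `M^γ_{v_j,v_j} = γ_j` and
`M^γ_{u_j,u_j} = γ_j⁻¹`. -/
noncomputable def robM {V : Type*} [Fintype V] [DecidableEq V] {k : ℕ}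
    (v u : Fin k → V) (γ : Fin k → ℂ) : Matrix V V ℂ :=
  Matrix.diagonal (fun x =>
    (∑ j, if x = v j then γ j else 0) + (∑ j, if x = u j then (γ j)⁻¹ else 0))

/-- The operator `H^γ = Q - C - M^γ`. -/
noncomputable def robH {V : Type*} [Fintype V] [DecidableEq V]
    (G : SimpleGraph V) [DecidableRel G.Adj] (q : V → ℝ) {k : ℕ}
    (v u : Fin k → V) (γ : Fin k → ℂ) : Matrix V V ℂ :=
  Matrix.diagonal (fun x => (q x : ℂ)) - G.adjMatrix ℂ - robM v u γ

/-- Action of `M^α` on a vector. -/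
lemma magM_mulVec {V : Type*} [Fintype V] [DecidableEq V] {k : ℕ}
    (v u : Fin k → V) (α : Fin k → ℝ) (g : V → ℂ) (x : V) :
    (magM v u α *ᵥ g) x =
      (∑ j, if x = v j then Complex.exp (Complex.I * α j) * g (u j) else 0) +
      (∑ j, if x = u j then Complex.exp (-(Complex.I * α j)) * g (v j) else 0) := by
  simp only [Matrix.mulVec, dotProduct, magM, add_mul, Finset.sum_add_distrib, Finset.sum_mul]
  congr 1
  · rw [Finset.sum_comm]
    refine Finset.sum_congr rfl fun j _ => ?_
    by_cases h : x = v j <;> simp [h]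
  · rw [Finset.sum_comm]
    refine Finset.sum_congr rfl fun j _ => ?_
    by_cases h : x = u j <;> simp [h]

/-- Sesquilinear form of `M^α`. -/
lemma dot_magM {V : Type*} [Fintype V] [DecidableEq V] {k : ℕ}
    (v u : Fin k → V) (α : Fin k → ℝ) (f g : V → ℂ) :
    f ⬝ᵥ (magM v u α *ᵥ g) =
      ∑ j, (f (v j) * (Complex.exp (Complex.I * α j) * g (u j)) +
        f (u j) * (Complex.exp (-(Complex.I * α j)) * g (v j))) := by
  simp only [dotProduct, magM_mulVec, mul_add, Finset.sum_add_distrib, Finset.mul_sum]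
  congr 1
  · rw [Finset.sum_comm]
    refine Finset.sum_congr rfl fun j _ => ?_
    simp
  · rw [Finset.sum_comm]
    refine Finset.sum_congr rfl fun j _ => ?_
    simp

lemma magH_herm {V : Type*} [Fintype V] [DecidableEq V]
    (G : SimpleGraph V) [DecidableRel G.Adj] (q : V → ℝ) {k : ℕ}
    (v u : Fin k → V) (α : Fin k → ℝ) : (magH G q v u α)ᴴ = magH G q v u α := by
  have h1 : (magM v u α)ᴴ = magM v u α := by
    ext x y
    simp only [Matrix.conjTranspose_apply, magM, star_add, star_sum]
    rw [add_comm]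
    congr 1
    · refine Finset.sum_congr rfl fun j _ => ?_
      simp only [and_comm (a := y = u j)]
      split_ifs <;> simp [← Complex.exp_conj]
    · refine Finset.sum_congr rfl fun j _ => ?_
      simp only [and_comm (a := y = v j)]
      split_ifs <;> simp [← Complex.exp_conj]
  have h2 : (G.adjMatrix ℂ)ᴴ = G.adjMatrix ℂ := by
    ext x y
    simp [Matrix.conjTranspose_apply, SimpleGraph.adjMatrix_apply, G.adj_comm, apply_ite]
  have h3 : (Matrix.diagonal (fun x => (q x : ℂ)))ᴴ = Matrix.diagonal (fun x => (q x : ℂ)) := by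
    rw [Matrix.diagonal_conjTranspose]
    congr 1
    ext x
    simp
  rw [magH, Matrix.conjTranspose_sub, Matrix.conjTranspose_sub, h1, h2, h3]

lemma magH_cont {V : Type*} [Fintype V] [DecidableEq V]
    (G : SimpleGraph V) [DecidableRel G.Adj] (q : V → ℝ) {k : ℕ}
    (v u : Fin k → V) : Continuous (fun α => magH G q v u α) := by
  unfold magH
  refine Continuous.sub continuous_const ?_
  refine continuous_matrix fun x y => ?_
  simp only [magM]
  refine Continuous.add ?_ ?_
  · refine continuous_finsetSum _ fun j _ => ?_
    split_ifs <;> fun_prop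
  · refine continuous_finsetSum _ fun j _ => ?_
    split_ifs <;> fun_prop

open Filter Topology in
/-- Feynman–Hellmann: criticality in direction `e_j`. -/
lemma feynman_hellmann
    {V : Type*} [Fintype V] [DecidableEq V]
    (G : SimpleGraph V) [DecidableRel G.Adj] (q : V → ℝ) {k : ℕ}
    (v u : Fin k → V)
    (lam : (Fin k → ℝ) → ℝ)
    (hlam : ∀ α, Module.End.HasEigenvalue (magH G q v u α).mulVecLin (lam α : ℂ))
    (αs : Fin k → ℝ)
    (hdiff : DifferentiableAt ℝ lam αs)
    (hcrit : fderiv ℝ lam αs = 0)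
    (hsimple : Module.finrank ℂ
      (Module.End.eigenspace (magH G q v u αs).mulVecLin (lam αs : ℂ)) = 1)
    (f : V → ℂ)
    (hf : (magH G q v u αs).mulVec f = (lam αs : ℂ) • f)
    (hf0 : f ≠ 0) (j : Fin k) :
    star (f (v j)) * (Complex.exp (Complex.I * αs j) * f (u j)) =
      star (f (u j)) * (Complex.exp (-(Complex.I * αs j)) * f (v j)) := by
  set e : Fin k → ℝ := Pi.single j 1 with he
  -- normalized eigenvectors
  have hex : ∀ α, ∃ g : V → ℂ, ‖g‖ = 1 ∧ magH G q v u α *ᵥ g = (lam α : ℂ) • g := by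
    intro α
    obtain ⟨g, hg⟩ := (hlam α).exists_hasEigenvector
    have hg1 : magH G q v u α *ᵥ g = (lam α : ℂ) • g := hg.apply_eq_smul
    refine ⟨((‖g‖⁻¹ : ℝ) : ℂ) • g, ?_, ?_⟩
    · rw [norm_smul]
      simp [norm_ne_zero_iff.mpr hg.2]
    · rw [Matrix.mulVec_smul, hg1, smul_comm]
  choose gg hgn hge using hex
  let t : ℕ → ℝ := fun n => 1 / ((n : ℝ) + 1)
  have ht0 : ∀ n, t n ≠ 0 := fun n => by positivity
  have htlim : Tendsto t atTop (𝓝 0) := tendsto_one_div_add_atTop_nhds_zero_nat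
  obtain ⟨g0, hg0, φ, hφ, hlimg⟩ := (isCompact_sphere (0 : V → ℂ) 1).tendsto_subseq
    (x := fun n => gg (αs + t n • e)) (fun n => by simp [hgn])
  have hs : Tendsto (fun n => t (φ n)) atTop (𝓝[≠] 0) := by
    refine tendsto_nhdsWithin_iff.mpr ⟨htlim.comp hφ.tendsto_atTop, ?_⟩
    exact Eventually.of_forall fun n => ht0 _
  have hs0 : Tendsto (fun n => t (φ n)) atTop (𝓝 0) := htlim.comp hφ.tendsto_atTop
  have hα : Tendsto (fun n => αs + t (φ n) • e) atTop (𝓝 αs) := by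
    have := (hs0.smul_const e).const_add αs
    simpa using this
  have hlamlim : Tendsto (fun n => lam (αs + t (φ n) • e)) atTop (𝓝 (lam αs)) :=
    hdiff.continuousAt.tendsto.comp hα
  have hlamlimC : Tendsto (fun n => (lam (αs + t (φ n) • e) : ℂ)) atTop (𝓝 (lam αs : ℂ)) :=
    (Complex.continuous_ofReal.tendsto _).comp hlamlim
  -- limit is an eigenvector
  have hg0e : magH G q v u αs *ᵥ g0 = (lam αs : ℂ) • g0 := by
    have hc : Continuous (fun p : (Fin k → ℝ) × (V → ℂ) => magH G q v u p.1 *ᵥ p.2) :=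
      Continuous.matrix_mulVec ((magH_cont G q v u).comp continuous_fst) continuous_snd
    have h1 := (hc.tendsto (αs, g0)).comp (hα.prodMk_nhds hlimg)
    have h2 := hlamlimC.smul hlimg
    refine tendsto_nhds_unique h1 (h2.congr fun n => ?_)
    exact (hge _).symm
  have hg0n : g0 ≠ 0 := by
    rintro rfl
    simp at hg0
  obtain ⟨c, hc⟩ : ∃ c : ℂ, c • f = g0 := by
    have := (finrank_eq_one_iff_of_nonzero'
      (⟨f, Module.End.mem_eigenspace_iff.mpr hf⟩ :
        Module.End.eigenspace (magH G q v u αs).mulVecLin (lam αs : ℂ))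
      (fun h => hf0 (congrArg Subtype.val h))).mp hsimple
      ⟨g0, Module.End.mem_eigenspace_iff.mpr hg0e⟩
    obtain ⟨c, hc⟩ := this
    exact ⟨c, congrArg Subtype.val hc⟩
  have hc0 : c ≠ 0 := by
    rintro rfl
    exact hg0n (by rw [← hc, zero_smul])
  -- the identity
  have hid : ∀ α (g : V → ℂ), magH G q v u α *ᵥ g = (lam α : ℂ) • g →
      ((lam α : ℂ) - lam αs) * (star f ⬝ᵥ g) =
        star f ⬝ᵥ (magM v u αs *ᵥ g) - star f ⬝ᵥ (magM v u α *ᵥ g) := by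
    intro α g hg
    have h1 : star f ⬝ᵥ (magH G q v u αs *ᵥ g) = (lam αs : ℂ) * (star f ⬝ᵥ g) := by
      have := congrArg star hf
      rw [Matrix.star_mulVec, magH_herm] at this
      rw [Matrix.dotProduct_mulVec, this]
      simp
    have h2 : star f ⬝ᵥ (magH G q v u α *ᵥ g) = (lam α : ℂ) * (star f ⬝ᵥ g) := by
      rw [hg, dotProduct_smul, smul_eq_mul]
    rw [sub_mul, ← h1, ← h2]
    simp only [magH, Matrix.sub_mulVec, dotProduct_sub]
    ring
  -- slopes
  have hslam : Tendsto (fun n => (t (φ n))⁻¹ * (lam (αs + t (φ n) • e) - lam αs)) atTop (𝓝 0) := by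
    have h1 : HasFDerivAt lam (0 : (Fin k → ℝ) →L[ℝ] ℝ) αs := hcrit ▸ hdiff.hasFDerivAt
    have h2 : HasLineDerivAt ℝ lam 0 αs e := by simpa using h1.hasLineDerivAt e
    have h3 := h2.tendsto_slope_zero.comp hs
    simpa [Function.comp_def] using h3
  have hslamC : Tendsto (fun n => ((t (φ n) : ℂ))⁻¹ * ((lam (αs + t (φ n) • e) : ℂ) - lam αs))
      atTop (𝓝 0) := by
    have := (Complex.continuous_ofReal.tendsto _).comp hslam
    simpa [Function.comp_def] using this
  have hsexp : ∀ (σ : ℂ) (l : Fin k), Tendsto (fun n => ((t (φ n) : ℂ))⁻¹ *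
      (Complex.exp (σ * ((αs + t (φ n) • e) l : ℝ)) - Complex.exp (σ * αs l)))
      atTop (𝓝 (Complex.exp (σ * αs l) * (σ * e l))) := by
    intro σ l
    have h1 : HasDerivAt (fun s : ℝ => Complex.exp (σ * ((αs + s • e) l : ℝ)))
        (Complex.exp (σ * αs l) * (σ * e l)) 0 := by
      have h2 : HasDerivAt (fun s : ℝ => (((αs + s • e) l : ℝ) : ℂ)) (e l : ℂ) 0 := by
        have h3 : HasDerivAt (fun s : ℝ => ((αs + s • e) l : ℝ)) (e l) 0 := by
          simpa using ((hasDerivAt_id (0 : ℝ)).mul_const (e l)).const_add (αs l)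
        exact h3.ofReal_comp
      have h4 := (h2.const_mul σ).cexp
      simpa using h4
    have h3 := h1.tendsto_slope_zero.comp hs
    simpa [Function.comp_def] using h3
  have hgl : ∀ x, Tendsto (fun n => gg (αs + t (φ n) • e) x) atTop (𝓝 (g0 x)) := fun x =>
    (tendsto_pi_nhds.mp hlimg) x
  have hR : Tendsto (fun n => ((t (φ n) : ℂ))⁻¹ *
      (star f ⬝ᵥ (magM v u αs *ᵥ gg (αs + t (φ n) • e)) -
       star f ⬝ᵥ (magM v u (αs + t (φ n) • e) *ᵥ gg (αs + t (φ n) • e)))) atTop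
      (𝓝 (-∑ l, (star f (v l) * ((Complex.exp (Complex.I * αs l) * (Complex.I * e l)) * g0 (u l)) +
        star f (u l) * ((Complex.exp (-Complex.I * αs l) * (-Complex.I * e l)) * g0 (v l))))) := by
    have h1 := (tendsto_finsetSum Finset.univ fun l _ =>
      (((hsexp Complex.I l).mul (hgl (u l))).const_mul (star f (v l))).add
      (((hsexp (-Complex.I) l).mul (hgl (v l))).const_mul (star f (u l)))).neg
    refine h1.congr fun n => ?_
    rw [dot_magM, dot_magM, ← Finset.sum_sub_distrib, Finset.mul_sum, ← Finset.sum_neg_distrib]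
    refine Finset.sum_congr rfl fun l _ => ?_
    simp only [neg_mul]
    ring
  have hL : Tendsto (fun n => ((t (φ n) : ℂ))⁻¹ *
      (star f ⬝ᵥ (magM v u αs *ᵥ gg (αs + t (φ n) • e)) -
       star f ⬝ᵥ (magM v u (αs + t (φ n) • e) *ᵥ gg (αs + t (φ n) • e)))) atTop (𝓝 0) := by
    have hd : Continuous (fun g : V → ℂ => star f ⬝ᵥ g) := by
      unfold dotProduct
      fun_prop
    have h1 := hslamC.mul ((hd.tendsto g0).comp hlimg)
    rw [zero_mul] at h1
    refine h1.congr fun n => ?_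
    rw [← hid _ _ (hge _)]
    simp only [Function.comp_apply]
    ring
  have hfin := tendsto_nhds_unique hR hL
  rw [Finset.sum_eq_single j (fun l _ hl => by simp [he, hl]) (by simp)] at hfin
  rw [← hc] at hfin
  simp only [he, Pi.single_eq_same, Complex.ofReal_one, mul_one, Pi.smul_apply, smul_eq_mul,
    Pi.star_apply, neg_mul] at hfin
  have h2 : (c * Complex.I) * (star (f (v j)) * (Complex.exp (Complex.I * αs j) * f (u j)) -
      star (f (u j)) * (Complex.exp (-(Complex.I * αs j)) * f (v j))) = 0 := by
    linear_combination -hfin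
  have h3 := (mul_eq_zero.mp h2).resolve_left (mul_ne_zero hc0 Complex.I_ne_zero)
  exact sub_eq_zero.mp h3

/-- **Theorem A.1, parts (1) and (2).** At an internal critical point `α*` of a simple
eigenvalue branch of the dispersion relation, with eigenvector `f` nonvanishing on the
quasi-connected vertices, the numbers `γ*_j = e^{iα*_j} f(u_j)/f(v_j)` are nonzero reals,
and `λ(α*)` is a degenerate eigenvalue of `H^{γ*}` (complex eigenspace of dimension ≥ 2). -/
theorem internal_critical_point_degeneracy_discrete
    {V : Type*} [Fintype V] [DecidableEq V]
    (G : SimpleGraph V) [DecidableRel G.Adj] (q : V → ℝ) {k : ℕ}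
    (v u : Fin k → V)
    (hdist : Function.Injective (Sum.elim v u : Fin k ⊕ Fin k → V))
    (hnoedge : ∀ j, ¬ G.Adj (v j) (u j))
    (lam : (Fin k → ℝ) → ℝ)
    (hlam : ∀ α, Module.End.HasEigenvalue (magH G q v u α).mulVecLin (lam α : ℂ))
    (αs : Fin k → ℝ)
    (hdiff : DifferentiableAt ℝ lam αs)
    (hcrit : fderiv ℝ lam αs = 0)
    (hsimple : Module.finrank ℂ
      (Module.End.eigenspace (magH G q v u αs).mulVecLin (lam αs : ℂ)) = 1)
    (hnotsym : ∃ j, Real.sin (αs j) ≠ 0)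
    (f : V → ℂ)
    (hf : (magH G q v u αs).mulVec f = (lam αs : ℂ) • f)
    (hv : ∀ j, f (v j) ≠ 0) (hu : ∀ j, f (u j) ≠ 0)
    (γs : Fin k → ℂ)
    (hγs : ∀ j, γs j = Complex.exp (Complex.I * αs j) * f (u j) / f (v j)) :
    (∀ j, γs j ≠ 0 ∧ (γs j).im = 0) ∧
      2 ≤ Module.finrank ℂ
        (Module.End.eigenspace (robH G q v u γs).mulVecLin (lam αs : ℂ)) := by
  have hγ0 : ∀ j, γs j ≠ 0 := fun j => by
    rw [hγs]
    exact div_ne_zero (mul_ne_zero (Complex.exp_ne_zero _) (hu j)) (hv j)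
  have hγr : ∀ j, star (γs j) = γs j := by
    intro j
    have h := feynman_hellmann G q v u lam hlam αs hdiff hcrit hsimple f hf
      (fun h => hv j (by simp [h])) j
    have hs : star (f (v j)) ≠ 0 := star_ne_zero.mpr (hv j)
    have he : star (Complex.exp (Complex.I * αs j)) = Complex.exp (-(Complex.I * αs j)) := by
      simp [← Complex.exp_conj]
    rw [hγs, star_div₀, star_mul', he, div_eq_div_iff hs (hv j)]
    linear_combination -h
  have hfγ : robH G q v u γs *ᵥ f = (lam αs : ℂ) • f := by
    rw [← hf]
    simp only [robH, magH, Matrix.sub_mulVec]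
    congr 1
    ext x
    rw [magM_mulVec, robM, Matrix.mulVec_diagonal, add_mul, Finset.sum_mul, Finset.sum_mul]
    congr 1
    · refine Finset.sum_congr rfl fun j _ => ?_
      split_ifs with h
      · rw [h, hγs, div_mul_cancel₀ _ (hv j)]
      · simp
    · refine Finset.sum_congr rfl fun j _ => ?_
      split_ifs with h
      · have := hu j
        have := hv j
        rw [h, hγs, Complex.exp_neg, inv_div]
        field_simp
      · simp
  have hcγ : robH G q v u γs *ᵥ star f = (lam αs : ℂ) • star f := by
    have h := congrArg star hfγ
    have hreal : (robH G q v u γs).map star = robH G q v u γs := by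
      ext x y
      simp only [robH, robM, Matrix.map_apply, Matrix.sub_apply, Matrix.diagonal_apply,
        SimpleGraph.adjMatrix_apply, star_sub]
      congr 1
      · congr 1
        · split_ifs <;> simp
        · split_ifs <;> simp
      · split_ifs
        · simp only [star_add, star_sum]
          congr 1
          · refine Finset.sum_congr rfl fun j _ => ?_
            split_ifs
            · exact hγr j
            · simp
          · refine Finset.sum_congr rfl fun j _ => ?_
            split_ifs
            · rw [star_inv₀, hγr j]
            · simp
        · simp
    have h2 : star (robH G q v u γs *ᵥ f) = (robH G q v u γs).map star *ᵥ star f := by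
      ext x
      simp [Matrix.mulVec, dotProduct]
    rw [h2, hreal] at h
    rw [h, star_smul]
    simp
  refine ⟨fun j => ⟨hγ0 j, Complex.conj_eq_iff_im.mp (hγr j)⟩, ?_⟩
  obtain ⟨j, hj⟩ := hnotsym
  by_contra hlt
  have hf0 : f ≠ 0 := fun h => hv j (by simp [h])
  have hne : (⟨f, Module.End.mem_eigenspace_iff.mpr hfγ⟩ :
      Module.End.eigenspace (robH G q v u γs).mulVecLin (lam αs : ℂ)) ≠ 0 :=
    fun h => hf0 (congrArg Subtype.val h)
  have hpos := Module.finrank_pos_iff_exists_ne_zero (R := ℂ)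
    (M := Module.End.eigenspace (robH G q v u γs).mulVecLin (lam αs : ℂ)) |>.mpr ⟨_, hne⟩
  have hone : Module.finrank ℂ
      (Module.End.eigenspace (robH G q v u γs).mulVecLin (lam αs : ℂ)) = 1 := by omega
  obtain ⟨c, hc⟩ := (finrank_eq_one_iff_of_nonzero' _ hne).mp hone
    ⟨star f, Module.End.mem_eigenspace_iff.mpr hcγ⟩
  have hc' : ∀ x, c * f x = star (f x) := fun x => congrFun (congrArg Subtype.val hc) x
  have h1 := hγr j
  have he : star (Complex.exp (Complex.I * αs j)) = Complex.exp (-(Complex.I * αs j)) := by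
    simp [← Complex.exp_conj]
  have hcn : c ≠ 0 := by
    rintro rfl
    have := hc' (v j)
    rw [zero_mul] at this
    exact star_ne_zero.mpr (hv j) this.symm
  have h2 : star (Complex.exp (Complex.I * αs j)) = Complex.exp (Complex.I * αs j) := by
    rw [hγs, star_div₀, star_mul', ← hc', ← hc'] at h1
    have := hv j
    have := hu j
    field_simp at h1
    exact h1
  have h3 := Complex.conj_eq_iff_im.mp h2
  rw [mul_comm, Complex.exp_ofReal_mul_I_im] at h3
  exact hj h3
end

section
/- In the discrete setup, let λ : ℝ^k → ℝ be a function such that λ(α) is an eigenvalue of H^α for every α ∈ ℝ^k, let α* ∈ ℝ^k be a critical point of λ (λ is differentiable at α* and its total derivative there is zero), suppose the eigenvalue λ(α*) of H^{α*} is simple (its eigenspace over ℂ is one-dimensional), suppose there exists j with sin(α*_j) ≠ 0 (i.e., α* is not at a symmetry point of the Brillouin zone), let f : V → ℂ be an eigenvector of H^{α*} for λ(α*) with f(v_j) ≠ 0 and f(u_j) ≠ 0 for all j = 1,…,k, and suppose in addition that the graph G is a tree (connected and without cycles). Then there exists a vertex w ∈ V of degree at least three in G such that f(w) = 0. -/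
open Matrix Complex BigOperators

open Filter Topology

lemma aux_magM_mulVec {V : Type*} [Fintype V] [DecidableEq V] {k : ℕ}
    (v u : Fin k → V) (α : Fin k → ℝ) (g : V → ℂ) (x : V) :
    (magM v u α).mulVec g x =
      (∑ j, if x = v j then Complex.exp (Complex.I * α j) * g (u j) else 0) +
      (∑ j, if x = u j then Complex.exp (-(Complex.I * α j)) * g (v j) else 0) := by
  simp only [Matrix.mulVec, dotProduct, magM, add_mul, Finset.sum_add_distrib, Finset.sum_mul]
  congr 1
  · rw [Finset.sum_comm]
    refine Finset.sum_congr rfl fun j _ => ?_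
    by_cases h : x = v j <;> simp [h]
  · rw [Finset.sum_comm]
    refine Finset.sum_congr rfl fun j _ => ?_
    by_cases h : x = u j <;> simp [h]

lemma aux_magM_form {V : Type*} [Fintype V] [DecidableEq V] {k : ℕ}
    (v u : Fin k → V) (α : Fin k → ℝ) (f g : V → ℂ) :
    star f ⬝ᵥ (magM v u α).mulVec g =
      ∑ j, (star (f (v j)) * (Complex.exp (Complex.I * α j) * g (u j)) +
        star (f (u j)) * (Complex.exp (-(Complex.I * α j)) * g (v j))) := by
  simp only [dotProduct, aux_magM_mulVec, mul_add, Finset.sum_add_distrib, Finset.mul_sum]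
  congr 1
  · rw [Finset.sum_comm]
    refine Finset.sum_congr rfl fun j _ => ?_
    simp
  · rw [Finset.sum_comm]
    refine Finset.sum_congr rfl fun j _ => ?_
    simp

lemma aux_conj_exp (a : ℝ) :
    (starRingEnd ℂ) (Complex.exp (Complex.I * a)) = Complex.exp (-(Complex.I * a)) := by
  rw [← Complex.exp_conj]; simp

lemma aux_magM_herm {V : Type*} [Fintype V] [DecidableEq V] {k : ℕ}
    (v u : Fin k → V) (α : Fin k → ℝ) : (magM v u α).IsHermitian := by
  ext x y
  simp only [Matrix.conjTranspose_apply, magM, star_add, star_sum]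
  rw [add_comm]
  congr 1
  · refine Finset.sum_congr rfl fun j _ => ?_
    by_cases h : x = v j ∧ y = u j
    · rw [if_pos h, if_pos h.symm]
      change (starRingEnd ℂ) _ = _
      rw [← aux_conj_exp]; simp
    · rw [if_neg h, if_neg (fun h' => h h'.symm)]; simp
  · refine Finset.sum_congr rfl fun j _ => ?_
    by_cases h : x = u j ∧ y = v j
    · rw [if_pos h, if_pos h.symm]
      exact aux_conj_exp _
    · rw [if_neg h, if_neg (fun h' => h h'.symm)]; simp

lemma aux_magH_herm {V : Type*} [Fintype V] [DecidableEq V]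
    (G : SimpleGraph V) [DecidableRel G.Adj] (q : V → ℝ) {k : ℕ}
    (v u : Fin k → V) (α : Fin k → ℝ) : (magH G q v u α).IsHermitian := by
  refine Matrix.IsHermitian.sub (Matrix.IsHermitian.sub ?_ ?_) (aux_magM_herm v u α)
  · ext x y
    by_cases h : x = y
    · subst h; simp
    · simp [h, Ne.symm h]
  · ext x y
    simp [G.adj_comm, apply_ite]

lemma aux_form_herm {V : Type*} [Fintype V] (A : Matrix V V ℂ) (hA : A.IsHermitian)
    (l : ℝ) (f g : V → ℂ) (hf : A.mulVec f = (l : ℂ) • f) :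
    star f ⬝ᵥ A.mulVec g = (l : ℂ) * (star f ⬝ᵥ g) := by
  rw [Matrix.dotProduct_mulVec]
  have : Matrix.vecMul (star f) A = (l : ℂ) • star f := by
    have h := congrArg star hf
    rw [Matrix.star_mulVec, hA.eq] at h
    rw [h]
    ext x; simp
  rw [this, smul_dotProduct, smul_eq_mul]

lemma aux_cur {a b : ℂ} (ha : a ≠ 0) (h : ((starRingEnd ℂ) a * b).im = 0) :
    ∃ r : ℝ, b = r * a := by
  refine ⟨((starRingEnd ℂ) a * b).re / Complex.normSq a, ?_⟩
  have h1 : ((((starRingEnd ℂ) a * b).re : ℝ) : ℂ) = (starRingEnd ℂ) a * b := by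
    apply Complex.ext <;> simp [h] 
  have h2 : (Complex.normSq a : ℂ) ≠ 0 := by
    simpa using ha
  rw [Complex.ofReal_div, h1]
  field_simp
  rw [← Complex.mul_conj]; ring

lemma aux_hellmann {V : Type*} [Fintype V] [DecidableEq V]
    (G : SimpleGraph V) [DecidableRel G.Adj] (q : V → ℝ) {k : ℕ}
    (v u : Fin k → V)
    (lam : (Fin k → ℝ) → ℝ)
    (hlam : ∀ α, Module.End.HasEigenvalue (magH G q v u α).mulVecLin (lam α : ℂ))
    (αs : Fin k → ℝ)
    (hdiff : DifferentiableAt ℝ lam αs)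
    (hcrit : fderiv ℝ lam αs = 0)
    (hsimple : Module.finrank ℂ
      (Module.End.eigenspace (magH G q v u αs).mulVecLin (lam αs : ℂ)) = 1)
    (f : V → ℂ)
    (hf : (magH G q v u αs).mulVec f = (lam αs : ℂ) • f) (hf0 : f ≠ 0) (j : Fin k) :
    ((starRingEnd ℂ) (f (v j)) * (Complex.exp (Complex.I * αs j) * f (u j))).im = 0 := by
  -- the line through `αs`
  set p : ℝ → (Fin k → ℝ) := fun t => αs + t • Pi.single j (1 : ℝ) with hp
  have hp0 : p 0 = αs := by simp [hp]
  have hpj : ∀ t, p t j = αs j + t := by intro t; simp [hp]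
  have hpi : ∀ t i, i ≠ j → p t i = αs i := by intro t i h; simp [hp, h]
  have hpder : HasDerivAt p (Pi.single j (1 : ℝ)) 0 := by
    have := ((hasDerivAt_id (0 : ℝ)).smul_const (Pi.single j (1 : ℝ) : Fin k → ℝ)).const_add αs
    rw [one_smul] at this
    exact this
  have hlder : HasDerivAt (fun t => lam (p t)) 0 0 := by
    have h1 : HasFDerivAt lam (0 : (Fin k → ℝ) →L[ℝ] ℝ) (p 0) := by
      rw [hp0, ← hcrit]; exact hdiff.hasFDerivAt
    have := h1.comp_hasDerivAt (0 : ℝ) hpder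
    rw [ContinuousLinearMap.zero_apply] at this
    exact this
  -- normalized eigenvectors
  have hex : ∀ α, ∃ g : V → ℂ, ‖g‖ = 1 ∧ (magH G q v u α).mulVec g = (lam α : ℂ) • g := by
    intro α
    obtain ⟨g, hg⟩ := (hlam α).exists_hasEigenvector
    have hgn : ‖g‖ ≠ 0 := norm_ne_zero_iff.mpr hg.2
    refine ⟨((‖g‖⁻¹ : ℝ) : ℂ) • g, ?_, ?_⟩
    · rw [norm_smul]; simp [hgn]
    · have := hg.apply_eq_smul
      rw [Matrix.mulVecLin_apply] at this
      rw [Matrix.mulVec_smul, this, smul_comm]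
  choose g hgn hge using hex
  set t : ℕ → ℝ := fun n => 1 / ((n : ℝ) + 1) with ht
  have ht0 : Tendsto t atTop (𝓝 0) := tendsto_one_div_add_atTop_nhds_zero_nat
  have htne : ∀ n, t n ≠ 0 := fun n => by positivity
  have htw : Tendsto t atTop (𝓝[≠] 0) :=
    tendsto_nhdsWithin_iff.mpr ⟨ht0, Eventually.of_forall htne⟩
  obtain ⟨g0, hg0, φ, hφ, hlim⟩ := (isCompact_sphere (0 : V → ℂ) 1).tendsto_subseq
    (x := fun n => g (p (t n))) (fun n => by simp [hgn])
  have htφ := htw.comp hφ.tendsto_atTop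
  have htφ0 : Tendsto (t ∘ φ) atTop (𝓝 0) := ht0.comp hφ.tendsto_atTop
  have hlim' : ∀ x, Tendsto (fun n => g (p (t (φ n))) x) atTop (𝓝 (g0 x)) :=
    fun x => (tendsto_pi_nhds.mp hlim) x
  have hlamlim : Tendsto (fun n => ((lam (p (t (φ n))) : ℝ) : ℂ)) atTop (𝓝 (lam αs : ℂ)) := by
    have := hlder.continuousAt.tendsto.comp htφ0
    rw [hp0] at this
    exact (Complex.continuous_ofReal.tendsto _).comp this
  have hexp1 : ∀ i, Tendsto (fun n => Complex.exp (Complex.I * (p (t (φ n)) i : ℝ))) atTop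
      (𝓝 (Complex.exp (Complex.I * (αs i : ℝ)))) := by
    intro i
    have hc : Continuous (fun s : ℝ => Complex.exp (Complex.I * (p s i : ℝ))) := by
      simp only [hp]; fun_prop
    have := (hc.tendsto 0).comp htφ0
    rw [hp0] at this
    exact this
  have hexp2 : ∀ i, Tendsto (fun n => Complex.exp (-(Complex.I * (p (t (φ n)) i : ℝ)))) atTop
      (𝓝 (Complex.exp (-(Complex.I * (αs i : ℝ))))) := by
    intro i
    have hc : Continuous (fun s : ℝ => Complex.exp (-(Complex.I * (p s i : ℝ)))) := by
      simp only [hp]; fun_prop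
    have := (hc.tendsto 0).comp htφ0
    rw [hp0] at this
    exact this
  -- limit is an eigenvector
  have hg0e : (magH G q v u αs).mulVec g0 = (lam αs : ℂ) • g0 := by
    have hcont : Continuous (fun s : ℝ => magH G q v u (p s)) := by
      refine continuous_matrix fun x y => ?_
      simp only [magH, Matrix.sub_apply, magM, hp]
      refine continuous_const.sub (Continuous.add ?_ ?_)
      · refine continuous_finset_sum _ fun i _ => ?_
        split_ifs <;> fun_prop
      · refine continuous_finset_sum _ fun i _ => ?_
        split_ifs <;> fun_prop
    have hM := (hcont.tendsto 0).comp htφ0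
    rw [hp0] at hM
    have hcv : Continuous (fun z : Matrix V V ℂ × (V → ℂ) => z.1.mulVec z.2) :=
      continuous_fst.matrix_mulVec continuous_snd
    have h1 := (hcv.tendsto (magH G q v u αs, g0)).comp (hM.prodMk_nhds hlim)
    have h2 := hlamlim.smul hlim
    refine tendsto_nhds_unique h1 (h2.congr fun n => ?_)
    simp only [Function.comp]
    exact (hge _).symm
  -- g0 = c f
  obtain ⟨c, hc⟩ : ∃ c : ℂ, c • f = g0 := by
    have hfm : f ∈ Module.End.eigenspace (magH G q v u αs).mulVecLin (lam αs : ℂ) := by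
      rw [Module.End.mem_eigenspace_iff]; exact hf
    have hgm : g0 ∈ Module.End.eigenspace (magH G q v u αs).mulVecLin (lam αs : ℂ) := by
      rw [Module.End.mem_eigenspace_iff]; exact hg0e
    obtain ⟨c, hc⟩ := (finrank_eq_one_iff_of_nonzero' (⟨f, hfm⟩ : Module.End.eigenspace
      (magH G q v u αs).mulVecLin (lam αs : ℂ)) (by simpa [Subtype.ext_iff] using hf0)).mp hsimple
      ⟨g0, hgm⟩
    exact ⟨c, congrArg Subtype.val hc⟩
  have hc0 : c ≠ 0 := by
    rintro rfl
    rw [zero_smul] at hc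
    rw [← hc] at hg0
    simp at hg0
  -- identity
  have hid : ∀ s : ℝ,
      star (f (v j)) * ((Complex.exp (Complex.I * (p s j : ℝ)) - Complex.exp (Complex.I * αs j))
          * g (p s) (u j)) +
      star (f (u j)) * ((Complex.exp (-(Complex.I * (p s j : ℝ)))
          - Complex.exp (-(Complex.I * αs j))) * g (p s) (v j))
        = -(((lam (p s) : ℂ) - lam αs) * (star f ⬝ᵥ g (p s))) := by
    intro s
    have h1 : star f ⬝ᵥ (magH G q v u (p s)).mulVec (g (p s)) =
        (lam (p s) : ℂ) * (star f ⬝ᵥ g (p s)) := by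
      rw [hge, dotProduct_smul, smul_eq_mul]
    have h2 := aux_form_herm _ (aux_magH_herm G q v u αs) _ f (g (p s)) hf
    have h3 : star f ⬝ᵥ (magM v u (p s)).mulVec (g (p s)) -
        star f ⬝ᵥ (magM v u αs).mulVec (g (p s)) =
        -(((lam (p s) : ℂ) - lam αs) * (star f ⬝ᵥ g (p s))) := by
      rw [sub_mul, ← h1, ← h2]
      simp only [magH, Matrix.sub_mulVec, dotProduct_sub]
      ring
    rw [← h3, aux_magM_form, aux_magM_form, ← Finset.sum_sub_distrib, Finset.sum_eq_single j]
    · ring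
    · intro i _ hij
      rw [hpi s i hij]; ring
    · simp
  -- derivatives
  have hd0 : HasDerivAt (fun s : ℝ => Complex.I * ((p s j : ℝ) : ℂ)) Complex.I 0 := by
    have : HasDerivAt (fun s : ℝ => (αs j : ℂ) + (s : ℂ)) 1 0 :=
      (Complex.ofRealCLM.hasDerivAt (x := (0 : ℝ))).const_add _
    have := this.const_mul Complex.I
    simpa [hpj] using this
  have hd1 := hd0.cexp
  have hd2 := hd0.neg.cexp
  have hd3 : HasDerivAt (fun s : ℝ => ((lam (p s) : ℝ) : ℂ)) ((0 : ℝ) : ℂ) 0 := hlder.ofReal_comp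
  have hs1 := (hasDerivAt_iff_tendsto_slope.mp hd1).comp htφ
  have hs2 := (hasDerivAt_iff_tendsto_slope.mp hd2).comp htφ
  have hs3 := (hasDerivAt_iff_tendsto_slope.mp hd3).comp htφ
  have hfg : Tendsto (fun n => star f ⬝ᵥ g (p (t (φ n)))) atTop (𝓝 (star f ⬝ᵥ g0)) := by
    unfold dotProduct
    exact tendsto_finset_sum _ fun x _ => (hlim' x).const_mul _
  have hL := ((hs1.mul (hlim' (u j))).const_mul (star (f (v j)))).add
    ((hs2.mul (hlim' (v j))).const_mul (star (f (u j))))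
  have hR := (hs3.mul hfg).neg
  have hfin := tendsto_nhds_unique hL (hR.congr fun n => by
    have := congrArg (fun z => (((t (φ n))⁻¹ : ℝ) : ℂ) * z) (hid (t (φ n)))
    simp only [Function.comp, slope, vsub_eq_sub, sub_zero, hp0, Complex.real_smul,
      Pi.neg_apply] at this ⊢
    linear_combination -this)
  simp only [Pi.neg_apply, hp0, ← hc, Pi.smul_apply, smul_eq_mul] at hfin
  have hfin2 : c * Complex.I * (star (f (v j)) * (Complex.exp (Complex.I * αs j) * f (u j))
      - star (f (u j)) * (Complex.exp (-(Complex.I * αs j)) * f (v j))) = 0 := by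
    simp only [Complex.ofReal_zero] at hfin
    linear_combination hfin
  have hfin3 := (mul_eq_zero.mp hfin2).resolve_left (mul_ne_zero hc0 Complex.I_ne_zero)
  rw [sub_eq_zero] at hfin3
  apply Complex.conj_eq_iff_im.mp
  rw [map_mul, map_mul, aux_conj_exp]
  simp only [Complex.conj_conj]
  change _ = star (f (v j)) * _
  rw [hfin3]
  change _ = (starRingEnd ℂ) (f (u j)) * _
  ring

lemma aux_tree_current {V : Type*} [Fintype V] [DecidableEq V]
    (G : SimpleGraph V) [DecidableRel G.Adj] (hac : G.IsAcyclic)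
    (J : V → V → ℝ) (hJ : ∀ x y, J x y = - J y x)
    (hdiv : ∀ x, ∑ y, (if G.Adj x y then J x y else 0) = 0)
    (x y : V) (hxy : G.Adj x y) : J x y = 0 := by
  classical
  have hb := (SimpleGraph.isAcyclic_iff_forall_isBridge.mp hac) (e := s(x, y)) hxy
  have hb' := SimpleGraph.isBridge_iff.mp hb
  set G' := G.deleteEdges {s(x, y)} with hG'
  set S : Finset V := Finset.univ.filter (fun s => G'.Reachable x s) with hS
  have hyS : y ∉ S := by
    simp only [hS, Finset.mem_filter, Finset.mem_univ, true_and]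
    exact hb'
  have hxS : x ∈ S := by simp [hS]
  set K : V → V → ℝ := fun a b => if G.Adj a b then J a b else 0 with hK
  have hKanti : ∀ a b, K a b = - K b a := by
    intro a b
    simp only [hK, G.adj_comm a b]
    split_ifs
    · exact hJ a b
    · simp
  have h0 : ∑ s ∈ S, ∑ b, K s b = 0 := Finset.sum_eq_zero fun s _ => hdiv s
  have hin : ∑ s ∈ S, ∑ b ∈ S, K s b = 0 := by
    have h1 : ∑ s ∈ S, ∑ b ∈ S, K s b = - ∑ s ∈ S, ∑ b ∈ S, K s b := by
      conv_lhs => rw [Finset.sum_comm]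
      rw [← Finset.sum_neg_distrib]
      refine Finset.sum_congr rfl fun a _ => ?_
      rw [← Finset.sum_neg_distrib]
      exact Finset.sum_congr rfl fun b _ => hKanti b a
    linarith
  have hout : ∑ s ∈ S, ∑ b ∈ Sᶜ, K s b = K x y := by
    have hz : ∀ s ∈ S, ∀ b ∈ Sᶜ, ¬ (s = x ∧ b = y) → K s b = 0 := by
      intro s hs b hbS hne
      simp only [hK]
      rw [if_neg]
      intro hadj
      have hbn : b ∉ S := Finset.mem_compl.mp hbS
      apply hbn
      have hs' : G'.Reachable x s := by simpa [hS] using hs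
      have hadj' : G'.Adj s b := by
        rw [hG', SimpleGraph.deleteEdges_adj]
        refine ⟨hadj, ?_⟩
        intro h
        rw [Set.mem_singleton_iff, Sym2.eq_iff] at h
        rcases h with h | h
        · exact hne h
        · exact hyS (h.1 ▸ hs)
      simpa [hS] using hs'.trans hadj'.reachable
    rw [Finset.sum_eq_single x, Finset.sum_eq_single y]
    · intro b hb1 hb2
      exact hz x hxS b hb1 (fun h => hb2 h.2)
    · intro h; exact absurd (Finset.mem_compl.mpr hyS) h
    · intro s hs hsx
      exact Finset.sum_eq_zero fun b hb1 => hz s hs b hb1 (fun h => hsx h.1)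
    · intro h; exact absurd hxS h
  have hsplit : ∑ s ∈ S, ∑ b, K s b = ∑ s ∈ S, ∑ b ∈ S, K s b + ∑ s ∈ S, ∑ b ∈ Sᶜ, K s b := by
    rw [← Finset.sum_add_distrib]
    exact Finset.sum_congr rfl fun s _ => (Finset.sum_add_sum_compl S _).symm
  rw [hsplit, hin, hout, zero_add] at h0
  simpa [hK, hxy] using h0

/-- A Fiedler-type statement: a complex solution of a real equation on a tree which does not
vanish at vertices of degree at least three is a complex multiple of a real function. -/
lemma aux_fiedler {V : Type*} [Fintype V] [DecidableEq V]
    (G : SimpleGraph V) [DecidableRel G.Adj] (hcon : G.Connected) (hac : G.IsAcyclic)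
    (f : V → ℂ) (r : V → ℝ)
    (heq : ∀ x, ∑ y ∈ G.neighborFinset x, f y = r x * f x)
    (hno : ∀ w, 3 ≤ G.degree w → f w ≠ 0) (x0 : V) (hx0 : f x0 ≠ 0) :
    ∀ x, ∃ a : ℝ, f x = a * f x0 := by
  have hcur : ∀ x y, G.Adj x y → ((starRingEnd ℂ) (f x) * f y).im = 0 := by
    refine aux_tree_current G hac (fun x y => ((starRingEnd ℂ) (f x) * f y).im) ?_ ?_
    · intro x y; simp; ring
    · intro x
      have h := congrArg (fun z => ((starRingEnd ℂ) (f x) * z).im) (heq x)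
      simp only [Finset.mul_sum, Complex.im_sum] at h
      rw [← Finset.sum_filter]
      have e : Finset.univ.filter (fun y => G.Adj x y) = G.neighborFinset x := by
        ext y; simp
      rw [e, h]
      simp; ring
  have hmul : ∀ x y, G.Adj x y → f x ≠ 0 → ∃ a : ℝ, f y = a * f x :=
    fun x y h hx => aux_cur hx (hcur x y h)
  set P : V → Prop := fun x => (∃ a : ℝ, f x = a * f x0) ∧
    ∀ y, G.Adj x y → ∃ a : ℝ, f y = a * f x0 with hP
  have hP0 : P x0 := ⟨⟨1, by simp⟩, fun y h => hmul x0 y h hx0⟩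
  have hstep : ∀ x y, G.Adj x y → P x → P y := by
    intro x y hxy hx
    obtain ⟨a, ha⟩ := hx.1
    obtain ⟨b, hb⟩ := hx.2 y hxy
    refine ⟨⟨b, hb⟩, fun z hyz => ?_⟩
    by_cases hfy : f y = 0
    · by_cases hzx : z = x
      · exact ⟨a, hzx ▸ ha⟩
      · have hsub : ({x, z} : Finset V) ⊆ G.neighborFinset y := by
          intro w hw
          simp only [Finset.mem_insert, Finset.mem_singleton] at hw
          rcases hw with rfl | rfl
          · simpa using hxy.symm
          · simpa using hyz
        have hdeg : G.degree y ≤ 2 := by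
          by_contra h
          exact hno y (by omega) hfy
        have heq2 : ({x, z} : Finset V) = G.neighborFinset y := by
          apply Finset.eq_of_subset_of_card_le hsub
          rw [Finset.card_pair (Ne.symm hzx), G.card_neighborFinset_eq_degree]
          exact hdeg
        have h := heq y
        rw [← heq2, Finset.sum_pair (Ne.symm hzx), hfy, mul_zero, ha] at h
        exact ⟨-a, by push_cast; linear_combination h⟩
    · obtain ⟨d, hd⟩ := hmul y z hyz hfy
      exact ⟨d * b, by rw [hd, hb]; push_cast; ring⟩
  have hall : ∀ x, P x := by
    intro x
    obtain ⟨w⟩ := hcon.preconnected x0 x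
    have key : ∀ {a b : V} (w : G.Walk a b), P a → P b := by
      intro a b w
      induction w with
      | nil => exact id
      | cons h _ ih => exact fun ha => ih (hstep _ _ h ha)
    exact key w hP0
  exact fun x => (hall x).1

/-- **Theorem A.1, part (3).** If, in addition to the hypotheses of the internal critical
point theorem, the fundamental domain `G` is a tree, then the eigenvector `f` vanishes at
some vertex of degree at least three. -/
theorem internal_critical_point_tree_zero_discrete
    {V : Type*} [Fintype V] [DecidableEq V]
    (G : SimpleGraph V) [DecidableRel G.Adj] (q : V → ℝ) {k : ℕ}
    (v u : Fin k → V)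
    (hdist : Function.Injective (Sum.elim v u : Fin k ⊕ Fin k → V))
    (hnoedge : ∀ j, ¬ G.Adj (v j) (u j))
    (lam : (Fin k → ℝ) → ℝ)
    (hlam : ∀ α, Module.End.HasEigenvalue (magH G q v u α).mulVecLin (lam α : ℂ))
    (αs : Fin k → ℝ)
    (hdiff : DifferentiableAt ℝ lam αs)
    (hcrit : fderiv ℝ lam αs = 0)
    (hsimple : Module.finrank ℂ
      (Module.End.eigenspace (magH G q v u αs).mulVecLin (lam αs : ℂ)) = 1)
    (hnotsym : ∃ j, Real.sin (αs j) ≠ 0)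
    (f : V → ℂ)
    (hf : (magH G q v u αs).mulVec f = (lam αs : ℂ) • f)
    (hv : ∀ j, f (v j) ≠ 0) (hu : ∀ j, f (u j) ≠ 0)
    (htree : G.Connected ∧ G.IsAcyclic) :
    ∃ w : V, 3 ≤ G.degree w ∧ f w = 0 := by
  by_contra hcon
  push Not at hcon
  obtain ⟨j0, hj0⟩ := hnotsym
  have hf0 : f ≠ 0 := fun h => hv j0 (by simp [h])
  have hcur := fun j => aux_hellmann G q v u lam hlam αs hdiff hcrit hsimple f hf hf0 j
  have hγ : ∀ j, ∃ γ : ℝ, Complex.exp (Complex.I * αs j) * f (u j) = γ * f (v j) :=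
    fun j => aux_cur (hv j) (hcur j)
  choose γ hγ using hγ
  have hγ0 : ∀ j, (γ j : ℂ) ≠ 0 := by
    intro j h
    have := hγ j
    rw [h, zero_mul] at this
    exact mul_ne_zero (Complex.exp_ne_zero _) (hu j) this
  have hγ' : ∀ j, Complex.exp (-(Complex.I * αs j)) * f (v j) = ((γ j)⁻¹ : ℝ) * f (u j) := by
    intro j
    have h1 : Complex.exp (-(Complex.I * αs j)) * Complex.exp (Complex.I * αs j) = 1 := by
      rw [← Complex.exp_add]; simp
    rw [Complex.ofReal_inv, eq_inv_mul_iff_mul_eq₀ (hγ0 j)]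
    linear_combination (-Complex.exp (-(Complex.I * αs j))) * hγ j + f (u j) * h1
  have hreal := aux_fiedler G htree.1 htree.2 f
    (fun x => q x - lam αs - ((∑ j, if x = v j then γ j else 0) +
      (∑ j, if x = u j then (γ j)⁻¹ else 0))) (by
      intro x
      have h := congrFun hf x
      have hM : (magM v u αs).mulVec f x = (((∑ j, if x = v j then γ j else 0) +
          (∑ j, if x = u j then (γ j)⁻¹ else 0) : ℝ) : ℂ) * f x := by
        rw [aux_magM_mulVec, Complex.ofReal_add, Complex.ofReal_sum, Complex.ofReal_sum, add_mul,
          Finset.sum_mul, Finset.sum_mul]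
        congr 1
        · refine Finset.sum_congr rfl fun j _ => ?_
          split_ifs with hx
          · rw [hγ, hx]
          · simp
        · refine Finset.sum_congr rfl fun j _ => ?_
          split_ifs with hx
          · rw [hγ', hx]
          · simp
      simp only [magH, Matrix.sub_mulVec, Pi.sub_apply, Matrix.mulVec_diagonal,
        SimpleGraph.adjMatrix_mulVec_apply, Pi.smul_apply, smul_eq_mul] at h
      rw [hM] at h
      rw [Complex.ofReal_sub, Complex.ofReal_sub]
      linear_combination -h) hcon (v j0) (hv j0)
  obtain ⟨b, hb⟩ := hreal (u j0)
  have hb0 : b ≠ 0 := by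
    rintro rfl
    exact hu j0 (by simpa using hb)
  have h := hγ j0
  rw [hb, ← mul_assoc] at h
  have h2 := congrArg Complex.im (mul_right_cancel₀ (hv j0) h)
  rw [mul_comm Complex.I, Complex.exp_mul_I, ← Complex.ofReal_cos, ← Complex.ofReal_sin] at h2
  simp at h2
  exact h2.elim hj0 hb0
end
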